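/- Let S be an inverse subsemigroup of FI₁ containing at least one non-idempotent element, and let S̄ be the inverse subsemigroup of S generated by all non-idempotent elements of S. Then S is finitely generated (there exists a finite F ⊆ S with ⟨F⟩ = S) if and only if the set S \ S̄ is finite. -/

import Mathlib

/-- Multiplication on triples modeling the monogenic free inverse semigroup:
the triple `(a, p, b)` encodes the element written `(-a, p, b)` in the paper. -/
def FI1mul (u v : ℤ × ℤ × ℤ) : ℤ × ℤ × ℤ :=
  (max u.1 (v.1 - u.2.1), u.2.1 + v.2.1, max u.2.2 (v.2.2 + u.2.1))

/-- Inversion on triples: `(a, p, b)⁻¹ = (a + p, -p, b - p)`. -/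
def FI1inv (u : ℤ × ℤ × ℤ) : ℤ × ℤ × ℤ :=
  (u.1 + u.2.1, -u.2.1, u.2.2 - u.2.1)

/-- The monogenic free inverse semigroup in its concrete triple model:
triples `(a, p, b)` with `a, b ∈ ℕ`, `a + b > 0` and `-a ≤ p ≤ b`. -/
def FI1 : Set (ℤ × ℤ × ℤ) :=
  {u | 0 ≤ u.1 ∧ 0 ≤ u.2.2 ∧ 0 < u.1 + u.2.2 ∧ -u.1 ≤ u.2.1 ∧ u.2.1 ≤ u.2.2}

/-- Membership in the smallest subset containing `X` that is closed under
multiplication and inversion. -/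
inductive FI1genMem (X : Set (ℤ × ℤ × ℤ)) : ℤ × ℤ × ℤ → Prop
  | base {u : ℤ × ℤ × ℤ} : u ∈ X → FI1genMem X u
  | mul {u v : ℤ × ℤ × ℤ} : FI1genMem X u → FI1genMem X v → FI1genMem X (FI1mul u v)
  | inv {u : ℤ × ℤ × ℤ} : FI1genMem X u → FI1genMem X (FI1inv u)

/-- `⟨X⟩`: the smallest subset containing `X` closed under multiplication and inversion. -/
def FI1gen (X : Set (ℤ × ℤ × ℤ)) : Set (ℤ × ℤ × ℤ) := {u | FI1genMem X u}

/-- A (nonempty) inverse subsemigroup of `FI₁`. -/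
def IsInvSub (S : Set (ℤ × ℤ × ℤ)) : Prop :=
  S.Nonempty ∧ S ⊆ FI1 ∧ (∀ u ∈ S, ∀ v ∈ S, FI1mul u v ∈ S) ∧ ∀ u ∈ S, FI1inv u ∈ S

theorem FI1mul_assoc (u v w : ℤ × ℤ × ℤ) :
    FI1mul (FI1mul u v) w = FI1mul u (FI1mul v w) := by
  simp only [FI1mul, Prod.mk.injEq]
  omega

theorem FI1inv_inv (u : ℤ × ℤ × ℤ) : FI1inv (FI1inv u) = u := by
  obtain ⟨a, p, b⟩ := u
  simp only [FI1inv, Prod.mk.injEq]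
  omega

theorem FI1inv_mul (u v : ℤ × ℤ × ℤ) :
    FI1inv (FI1mul u v) = FI1mul (FI1inv v) (FI1inv u) := by
  simp only [FI1mul, FI1inv, Prod.mk.injEq]
  omega

theorem FI1mul_self_eq_iff (u : ℤ × ℤ × ℤ) : FI1mul u u = u ↔ u.2.1 = 0 := by
  obtain ⟨a, p, b⟩ := u
  simp only [FI1mul, Prod.mk.injEq]
  omega

theorem FI1mul_self_ne_iff (u : ℤ × ℤ × ℤ) : FI1mul u u ≠ u ↔ u.2.1 ≠ 0 :=
  (FI1mul_self_eq_iff u).not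

theorem FI1gen_subset {X S : Set (ℤ × ℤ × ℤ)} (hS : IsInvSub S) (hX : X ⊆ S) :
    FI1gen X ⊆ S := by
  intro u hu
  induction hu with
  | base h => exact hX h
  | mul _ _ hu hv => exact hS.2.2.1 _ hu _ hv
  | inv _ hu => exact hS.2.2.2 _ hu

theorem FI1genMem.trans {X Y : Set (ℤ × ℤ × ℤ)} (h : X ⊆ FI1gen Y) {u : ℤ × ℤ × ℤ}
    (hu : FI1genMem X u) : FI1genMem Y u := by
  induction hu with
  | base hu => exact h hu
  | mul _ _ hu hv => exact hu.mul hv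
  | inv _ hu => exact hu.inv

theorem FI1genMem.mono {X Y : Set (ℤ × ℤ × ℤ)} (h : X ⊆ Y) {u : ℤ × ℤ × ℤ}
    (hu : FI1genMem X u) : FI1genMem Y u :=
  hu.trans fun _ hx => .base (h hx)

/-- The non-idempotent elements of `S` generate a two-sided ideal of `S`. -/
theorem FI1genMem.mul_mem_ideal {S : Set (ℤ × ℤ × ℤ)} (hS : IsInvSub S) {u : ℤ × ℤ × ℤ}
    (hu : FI1genMem {u | u ∈ S ∧ FI1mul u u ≠ u} u) :
    ∀ v ∈ S, FI1genMem {u | u ∈ S ∧ FI1mul u u ≠ u} (FI1mul u v) ∧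
      FI1genMem {u | u ∈ S ∧ FI1mul u u ≠ u} (FI1mul v u) := by
  induction hu with
  | @base u hu =>
    intro v hv
    by_cases hp : v.2.1 = 0
    · have hu' := (FI1mul_self_ne_iff u).1 hu.2
      refine ⟨.base ⟨hS.2.2.1 _ hu.1 _ hv, (FI1mul_self_ne_iff _).2 ?_⟩,
        .base ⟨hS.2.2.1 _ hv _ hu.1, (FI1mul_self_ne_iff _).2 ?_⟩⟩ <;>
      · simp only [FI1mul]
        omega
    · have hv' := FI1genMem.base (X := {u | u ∈ S ∧ FI1mul u u ≠ u})
        ⟨hv, (FI1mul_self_ne_iff v).2 hp⟩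
      exact ⟨(FI1genMem.base hu).mul hv', hv'.mul (.base hu)⟩
  | mul hu hw ihu ihw =>
    intro v hv
    rw [FI1mul_assoc, ← FI1mul_assoc v]
    exact ⟨hu.mul (ihw v hv).1, (ihu v hv).2.mul hw⟩
  | inv hu ih =>
    intro v hv
    have h := ih _ (hS.2.2.2 v hv)
    have h1 := h.1.inv
    have h2 := h.2.inv
    rw [FI1inv_mul, FI1inv_inv] at h1 h2
    exact ⟨h2, h1⟩

/-- An element of `⟨F⟩` outside the ideal generated by the non-idempotents is an idempotent
whose coordinates occur in `F`. -/
theorem FI1genMem.mem_ideal_or {S F : Set (ℤ × ℤ × ℤ)} (hS : IsInvSub S) (hF : F ⊆ S)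
    {u : ℤ × ℤ × ℤ} (hu : FI1genMem F u) :
    FI1genMem {u | u ∈ S ∧ FI1mul u u ≠ u} u ∨
      (u.2.1 = 0 ∧ u.1 ∈ (fun x => x.1) '' F ∧ u.2.2 ∈ (fun x => x.2.2) '' F) := by
  induction hu with
  | @base u hu =>
    by_cases hp : u.2.1 = 0
    · exact .inr ⟨hp, ⟨u, hu, rfl⟩, ⟨u, hu, rfl⟩⟩
    · exact .inl (.base ⟨hF hu, (FI1mul_self_ne_iff u).2 hp⟩)
  | @mul u v hu hv ihu ihv =>
    rcases ihu with ihu | ⟨hpu, hau, hbu⟩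
    · exact .inl (ihu.mul_mem_ideal hS v (FI1gen_subset hS hF hv)).1
    rcases ihv with ihv | ⟨hpv, hav, hbv⟩
    · exact .inl (ihv.mul_mem_ideal hS u (FI1gen_subset hS hF hu)).2
    refine .inr ⟨by simp [FI1mul, hpu, hpv], ?_, ?_⟩
    · simp only [FI1mul, hpu, sub_zero]
      rcases max_choice u.1 v.1 with h | h <;> rwa [h]
    · simp only [FI1mul, hpu, add_zero]
      rcases max_choice u.2.2 v.2.2 with h | h <;> rwa [h]
  | @inv u hu ih =>
    rcases ih with ih | ⟨hp, ha, hb⟩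
    · exact .inl ih.inv
    · exact .inr (by simpa [FI1inv, hp] using And.intro ha hb)

theorem FI1genMem.pow {X : Set (ℤ × ℤ × ℤ)} {a p c : ℤ} (hp : 0 < p)
    (h : FI1genMem X (a, p, p + c)) (n : ℕ) :
    FI1genMem X (a, (n + 1) * p, (n + 1) * p + c) := by
  induction n with
  | zero => simpa using h
  | succ n ih =>
    have hn : 0 ≤ (n : ℤ) * p := by positivity
    have e : FI1mul (a, (n + 1) * p, (n + 1) * p + c) (a, p, p + c) =
        (a, ((n + 1 : ℕ) + 1) * p, ((n + 1 : ℕ) + 1) * p + c) := by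
      simp only [FI1mul, Prod.mk.injEq, Nat.cast_add, Nat.cast_one, add_mul, one_mul, true_and]
      omega
    exact e ▸ ih.mul h

/-- If `p₁` is large relative to `a₀` and `c₀`, then `(a, p₁, p₁ + c)` and `(a₀, p₀, p₀ + c₀)`
generate every `(a, p, p + c)` with `p` large and congruent to `p₁` modulo `p₀`. -/
theorem FI1genMem.of_emod_eq {X : Set (ℤ × ℤ × ℤ)} {a₀ p₀ c₀ a p₁ c p : ℤ}
    (hp₀ : 0 < p₀) (hp₁ : 0 < p₁) (ha : 0 ≤ a) (hc : 0 ≤ c) (ha₀ : a₀ ≤ p₁) (hc₀ : c₀ ≤ p₁)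
    (hg : FI1genMem X (a₀, p₀, p₀ + c₀)) (hx : FI1genMem X (a, p₁, p₁ + c))
    (hmod : p % p₀ = p₁ % p₀) (hp : p₁ + p₀ * p₁ < p) : FI1genMem X (a, p, p + c) := by
  obtain ⟨j, hj⟩ : ∃ j, p = p₁ + p₀ * p₁ + p₀ * j := by
    obtain ⟨j, hj⟩ := Int.ModEq.dvd (show p₁ ≡ p [ZMOD p₀] from hmod.symm)
    exact ⟨j - p₁, by linear_combination hj⟩
  have hj0 : 0 < j := by
    by_contra! h
    nlinarith
  obtain ⟨m, rfl⟩ : ∃ m : ℕ, j = m + 1 := ⟨(j - 1).toNat, by omega⟩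
  obtain ⟨n, rfl⟩ : ∃ n : ℕ, p₀ = n + 1 := ⟨(p₀ - 1).toNat, by omega⟩
  have e : FI1mul (FI1mul (a, p₁, p₁ + c)
      (a₀, (m + 1) * ((n : ℤ) + 1), (m + 1) * ((n : ℤ) + 1) + c₀))
      (a, (n + 1) * p₁, (n + 1) * p₁ + c) = (a, p, p + c) := by
    have h1 : 0 < (m + 1) * ((n : ℤ) + 1) := by positivity
    have h2 : 0 ≤ n * p₁ := by positivity
    have h3 : ((n : ℤ) + 1) * (m + 1) = (m + 1) * ((n : ℤ) + 1) := mul_comm _ _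
    have h4 : ((n : ℤ) + 1) * p₁ = n * p₁ + p₁ := by ring
    rw [h3] at hj
    simp only [FI1mul, Prod.mk.injEq]
    generalize (m + 1) * ((n : ℤ) + 1) = s at *
    generalize ((n : ℤ) + 1) * p₁ = t at *
    omega
  exact e ▸ (hx.mul (hg.pow hp₀ m)).mul (hx.pow hp₁ n)

theorem FI1.exists_finite_gen_class {N : Set (ℤ × ℤ × ℤ)} (hN : N ⊆ FI1)
    {g : ℤ × ℤ × ℤ} (hg : g ∈ N) (hg0 : 0 < g.2.1) (a c r : ℤ) :
    ∃ F : Set (ℤ × ℤ × ℤ), F.Finite ∧ F ⊆ N ∧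
      ∀ p, 0 < p → p % g.2.1 = r → (a, p, p + c) ∈ N → (a, p, p + c) ∈ FI1gen F := by
  obtain ⟨a₀, p₀, b₀⟩ := g
  obtain ⟨c₀, rfl⟩ : ∃ c₀, b₀ = p₀ + c₀ := ⟨b₀ - p₀, by ring⟩
  simp only at hg0 ⊢
  have hfin (B : ℤ) : (N ∩ (fun p => (a, p, p + c)) '' Set.Icc 0 B).Finite :=
    ((Set.finite_Icc 0 B).image _).inter_of_right _
  by_cases h : ∃ p₁, max a₀ c₀ ≤ p₁ ∧ 0 < p₁ ∧ p₁ % p₀ = r ∧ (a, p₁, p₁ + c) ∈ N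
  · obtain ⟨p₁, hB, hp₁, hr, hx⟩ := h
    have hx1 := hN hx
    simp only [FI1, Set.mem_ofPred_eq] at hx1
    refine ⟨(N ∩ (fun p => (a, p, p + c)) '' Set.Icc 0 (p₁ + p₀ * p₁)) ∪
      {(a, p₁, p₁ + c), (a₀, p₀, p₀ + c₀)}, (hfin _).union (by simp), ?_, ?_⟩
    · rintro u (hu | rfl | rfl)
      exacts [hu.1, hx, hg]
    · intro p hp hpr hpN
      by_cases hle : p ≤ p₁ + p₀ * p₁
      · exact .base (.inl ⟨hpN, p, ⟨hp.le, hle⟩, rfl⟩)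
      · exact FI1genMem.of_emod_eq (a₀ := a₀) (c₀ := c₀) (p₁ := p₁) hg0 hp₁ (by omega)
          (by omega) (by omega) (by omega) (.base (by simp)) (.base (by simp)) (hpr.trans hr.symm) (by omega)
  · refine ⟨_, hfin (max a₀ c₀), Set.inter_subset_left, fun p hp hpr hpN => ?_⟩
    refine .base ⟨hpN, p, ⟨hp.le, ?_⟩, rfl⟩
    by_contra! hlt
    exact h ⟨p, hlt.le, hp, hpr, hpN⟩

/-- The non-idempotent elements of `S` are all generated by finitely many of them. -/
theorem IsInvSub.exists_finite_gen_nonidempotent {S : Set (ℤ × ℤ × ℤ)} (hS : IsInvSub S)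
    (hni : ∃ u ∈ S, FI1mul u u ≠ u) :
    ∃ F : Set (ℤ × ℤ × ℤ), F.Finite ∧ F ⊆ {u | u ∈ S ∧ FI1mul u u ≠ u} ∧
      {u | u ∈ S ∧ FI1mul u u ≠ u} ⊆ FI1gen F := by
  simp only [FI1mul_self_ne_iff] at hni ⊢
  set N : Set (ℤ × ℤ × ℤ) := {u | u ∈ S ∧ u.2.1 ≠ 0} with hNdef
  have hN : N ⊆ FI1 := fun u hu => hS.2.1 hu.1
  set P : Set (ℤ × ℤ × ℤ) := {u | u ∈ S ∧ 0 < u.2.1} with hPdef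
  have hP : P.Nonempty := by
    obtain ⟨u, hu, hp⟩ := hni
    rcases lt_or_gt_of_ne hp with h | h
    · exact ⟨FI1inv u, hS.2.2.2 u hu, by simpa [FI1inv] using h⟩
    · exact ⟨u, hu, h⟩
  obtain ⟨h, ⟨hhS, hh0⟩, hmin⟩ :=
    (measure fun u : ℤ × ℤ × ℤ => (u.2.2 - u.2.1).toNat).wf.has_min P hP
  obtain ⟨k, ⟨hkS, hk0⟩, kmin⟩ :=
    (measure fun u : ℤ × ℤ × ℤ => u.1.toNat).wf.has_min P hP
  have hhN : h ∈ N := ⟨hhS, hh0.ne'⟩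
  choose G hGfin hGN hG using FI1.exists_finite_gen_class hN hhN hh0
  let I : Set (ℤ × ℤ × ℤ) := Set.Icc 0 (h.1 + h.2.1) ×ˢ Set.Icc 0 k.2.2 ×ˢ Set.Icc 0 h.2.1
  have hI : I.Finite := (Set.finite_Icc _ _).prod ((Set.finite_Icc _ _).prod (Set.finite_Icc _ _))
  let F : Set (ℤ × ℤ × ℤ) := (⋃ i ∈ I, G i.1 i.2.1 i.2.2) ∪ {h, k}
  have hF : F.Finite := (hI.biUnion fun i _ => hGfin _ _ _).union (by simp)
  have hhF : FI1genMem F h := .base (.inr (by simp))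
  have hkF : FI1genMem F k := .base (.inr (by simp))
  have key : ∀ n : ℕ, ∀ u ∈ P, (u.1 + (u.2.2 - u.2.1)).toNat = n → FI1genMem F u := by
    intro n
    induction n using Nat.strong_induction_on with
    | _ n ih =>
      intro u hu hn
      have hmin' := hmin u hu
      have kmin' := kmin u hu
      have hu1 := hS.2.1 hu.1
      have hh1 := hS.2.1 hhS
      have hk1 := hS.2.1 hkS
      obtain ⟨huS, hu0⟩ := hu
      have hhu := hS.2.2.1 _ hhS _ huS
      have huk := hS.2.2.1 _ huS _ hkS
      obtain ⟨a, p, b⟩ := u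
      obtain ⟨a₁, p₁, b₁⟩ := h
      obtain ⟨a₂, p₂, b₂⟩ := k
      simp only [FI1, Set.mem_ofPred_eq, WellFoundedRelation.rel, InvImage]
        at hmin' kmin' hu1 hh1 hk1 hu0 hh0 hk0 hn
      by_cases hA : a ≤ a₁ + p₁
      · by_cases hC : b - p ≤ b₂
        · have hb : b = p + (b - p) := by ring
          have hmem : (a, p, b) ∈ FI1gen (G a (b - p) (p % p₁)) := by
            have := hG a (b - p) (p % p₁) p hu0 rfl (hb ▸ ⟨huS, hu0.ne'⟩)
            rwa [← hb] at this
          refine FI1genMem.mono (fun x hx => .inl ?_) hmem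
          simp only [Set.mem_iUnion]
          exact ⟨(a, b - p, p % p₁), ⟨⟨hu1.1, hA⟩, ⟨by simp only; omega, hC⟩,
            ⟨Int.emod_nonneg _ hh0.ne', (Int.emod_lt_of_pos _ hh0).le⟩⟩, hx⟩
        · have e : FI1mul (FI1mul (a, p, b) (a₂, p₂, b₂)) (FI1inv (a₂, p₂, b₂)) = (a, p, b) := by
            simp only [FI1mul, FI1inv, Prod.mk.injEq]
            omega
          refine e ▸ (ih _ ?_ _ ⟨huk, ?_⟩ rfl).mul hkF.inv <;> simp only [FI1mul] <;> omega
      · have e : FI1mul (FI1inv (a₁, p₁, b₁)) (FI1mul (a₁, p₁, b₁) (a, p, b)) = (a, p, b) := by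
          simp only [FI1mul, FI1inv, Prod.mk.injEq]
          omega
        refine e ▸ hhF.inv.mul (ih _ ?_ _ ⟨hhu, ?_⟩ rfl) <;> simp only [FI1mul] <;> omega
  refine ⟨F, hF, ?_, ?_⟩
  · rintro u (hu | rfl | rfl)
    · simp only [Set.mem_iUnion] at hu
      obtain ⟨i, -, hi⟩ := hu
      exact hGN _ _ _ hi
    · exact hhN
    · exact ⟨hkS, hk0.ne'⟩
  · rintro u ⟨huS, hp⟩
    rcases lt_or_gt_of_ne hp with hlt | hgt
    · have := (key _ (FI1inv u) ⟨hS.2.2.2 u huS, by simpa [FI1inv] using hlt⟩ rfl).inv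
      rwa [FI1inv_inv] at this
    · exact key _ u ⟨huS, hgt⟩ rfl

theorem stmt_18 (S : Set (ℤ × ℤ × ℤ)) (hS : IsInvSub S)
    (hni : ∃ u ∈ S, FI1mul u u ≠ u) :
    (∃ F : Finset (ℤ × ℤ × ℤ), ↑F ⊆ S ∧ FI1gen ↑F = S) ↔
      (S \ FI1gen {u | u ∈ S ∧ FI1mul u u ≠ u}).Finite := by
  constructor
  · rintro ⟨F, hFS, hF⟩
    refine (((F.finite_toSet.image fun x => x.1).prod ((Set.finite_singleton (0 : ℤ)).prod
      (F.finite_toSet.image fun x => x.2.2)))).subset ?_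
    rintro u ⟨huS, hu⟩
    rw [← hF] at huS
    obtain ⟨hp, ha, hb⟩ := (FI1genMem.mem_ideal_or hS hFS huS).resolve_left hu
    exact ⟨ha, hp, hb⟩
  · intro hfin
    obtain ⟨F, hF, hFN, hNF⟩ := hS.exists_finite_gen_nonidempotent hni
    have hsub : F ∪ (S \ FI1gen {u | u ∈ S ∧ FI1mul u u ≠ u}) ⊆ S :=
      Set.union_subset (fun u hu => (hFN hu).1) Set.sdiff_subset
    refine ⟨(hF.union hfin).toFinset, by simpa using hsub, ?_⟩
    rw [Set.Finite.coe_toFinset]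
    refine (FI1gen_subset hS hsub).antisymm fun u hu => ?_
    by_cases h : u ∈ FI1gen {u | u ∈ S ∧ FI1mul u u ≠ u}
    · exact (FI1genMem.trans hNF h).mono Set.subset_union_left
    · exact .base (.inr ⟨hu, h⟩)
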